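/- For each (I,J) ∈ O, the quotient topological space obtained from the closure cl(A_{I,J}) (taken in ℝ^{n−1}) by identifying all points of cl(A_{I,J}) ∖ A_{I,J} to a single point is homeomorphic to the (n−1)-dimensional sphere S^{n−1}. -/

import Mathlib

open Finset

/-- The maximum of `|z i - z j|` over `j ∈ S`, with the convention `max ∅ = 0`. -/
noncomputable def maxDist {n : ℕ} (z : Fin n → ℝ) (i : Fin n) (S : Finset (Fin n)) : ℝ :=
  if h : S.Nonempty then S.sup' h (fun j => |z i - z j|) else 0

/-- `ν^z_{I,i}`: the minimum over all subsets `S ⊆ I \ {i}` with `|S| = ⌊n/3⌋` of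
`max_{j ∈ S} |z i - z j|`, with the convention `min ∅ = 0`. -/
noncomputable def nu (n : ℕ) (z : Fin n → ℝ) (I : Finset (Fin n)) (i : Fin n) : ℝ :=
  if h : ((I.erase i).powersetCard (n / 3)).Nonempty then
    ((I.erase i).powersetCard (n / 3)).inf' h (maxDist z i)
  else 0

/-- `ν^z_I = max_{i ∈ I} ν^z_{I,i}`, with the convention `max ∅ = 0`. -/
noncomputable def nuMax (n : ℕ) (z : Fin n → ℝ) (I : Finset (Fin n)) : ℝ :=
  if h : I.Nonempty then I.sup' h (nu n z I) else 0

/-- `δ^z = (max{t₁,…,tₙ} - min{t₁,…,tₙ}) / n`. -/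
noncomputable def delta (n : ℕ) (z : Fin n → ℝ) : ℝ :=
  if h : (Finset.univ : Finset (Fin n)).Nonempty then
    (Finset.univ.sup' h z - Finset.univ.inf' h z) / n
  else 0

/-- `ẏ = (t₁, …, t_{n-1}, 0) ∈ ℝⁿ` for `y = (t₁, …, t_{n-1}) ∈ ℝ^{n-1}`. -/
def ydot (n : ℕ) (y : Fin (n - 1) → ℝ) : Fin n → ℝ :=
  fun i => if h : (i : ℕ) < n - 1 then y ⟨i, h⟩ else 0

/-- The open cube `(-1, 1)^m`, the interior of `D^m = [-1,1]^m`. -/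
def IntD (m : ℕ) : Set (Fin m → ℝ) := {y | ∀ i, y i ∈ Set.Ioo (-1 : ℝ) 1}

/-- `(I, J) ∈ O`: `I` and `J` are disjoint nonempty subsets of `[n]` with `I ∪ J = [n]`,
`|I| > n/3`, and `|J| > n/3`. -/
def memO (n : ℕ) (I J : Finset (Fin n)) : Prop :=
  I.Nonempty ∧ J.Nonempty ∧ Disjoint I J ∧ I ∪ J = Finset.univ ∧
    (n : ℝ) < 3 * I.card ∧ (n : ℝ) < 3 * J.card

/-- The set `A_{I,J}`. -/
def setAIJ (n : ℕ) (I J : Finset (Fin n)) : Set (Fin (n - 1) → ℝ) :=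
  {y | y ∈ IntD (n - 1) ∧ ∀ i ∈ I, ∀ j ∈ J,
    delta n (ydot n y) < ydot n y j - ydot n y i ∧
    nu n (ydot n y) I i < delta n (ydot n y) ∧
    nu n (ydot n y) J j < delta n (ydot n y)}

/-- The set `A = { y ∈ Int(D^{n-1}) : ν^{ẏ}_{[n]} < δ^{ẏ} }`. -/
def setA (n : ℕ) : Set (Fin (n - 1) → ℝ) :=
  {y | y ∈ IntD (n - 1) ∧ nuMax n (ydot n y) Finset.univ < delta n (ydot n y)}

/-- The point `b ∈ ℝ^{n-1}` associated to `(I, J) ∈ O`: if `n ∈ J` then `b_i = -1/2` for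
`i ∈ I` and `b_j = 0` for `j ∈ J \ {n}`; if `n ∈ I` then `b_i = 0` for `i ∈ I \ {n}` and
`b_j = 1/2` for `j ∈ J`. -/
noncomputable def bpt (n : ℕ) (I J : Finset (Fin n)) : Fin (n - 1) → ℝ :=
  fun i =>
    if (⟨n - 1, by have := i.isLt; omega⟩ : Fin n) ∈ J then
      (if Fin.castLE (Nat.sub_le n 1) i ∈ I then -(1 / 2 : ℝ) else 0)
    else
      (if Fin.castLE (Nat.sub_le n 1) i ∈ I then 0 else (1 / 2 : ℝ))

/-- If `U` is open with compact closure and `U` is not closed, then collapsing the complement of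
`U` in its closure to a point yields the one-point compactification of `U`. -/
theorem nonempty_quot_closure_homeomorph_onePoint {X : Type*} [TopologicalSpace X] [T2Space X]
    [LocallyCompactSpace X] {U : Set X} (hU : IsOpen U) (hc : IsCompact (closure U))
    (hne : (closure U \ U).Nonempty) :
    Nonempty (Quot (fun x y : closure U => (x : X) ∉ U ∧ (y : X) ∉ U) ≃ₜ OnePoint U) := by
  classical
  have : LocallyCompactSpace U := hU.locallyCompactSpace
  have : CompactSpace (closure U) := isCompact_iff_compactSpace.mp hc
  let f : closure U → OnePoint U := fun x => if h : (x : X) ∈ U then ((⟨x, h⟩ : U) : OnePoint U)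
    else OnePoint.infty
  have f_pos : ∀ (x : closure U) (h : (x : X) ∈ U), f x = ((⟨x, h⟩ : U) : OnePoint U) :=
    fun x h => dif_pos h
  have f_neg : ∀ (x : closure U), (x : X) ∉ U → f x = OnePoint.infty := fun x h => dif_neg h
  have hpre : ∀ s : Set U, f ⁻¹' ((↑) '' s) = Subtype.val ⁻¹' ((↑) '' s : Set X) := by
    intro s
    ext x
    by_cases h : (x : X) ∈ U
    · simp [f_pos x h, h]
    · simp [f_neg x h, h]
  have hf : Continuous f := by
    refine continuous_def.mpr fun s hs => ?_
    by_cases hi : OnePoint.infty ∈ s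
    · obtain ⟨-, hk⟩ := (OnePoint.isOpen_iff_of_mem hi).mp hs
      have hs' : s = ((↑) '' ((↑) ⁻¹' s : Set U)ᶜ : Set (OnePoint U))ᶜ := by
        rw [OnePoint.compl_image_coe, compl_compl, Set.image_preimage_eq_inter_range]
        ext y
        induction y using OnePoint.rec <;> simp [hi]
      rw [hs', Set.preimage_compl, hpre, isOpen_compl_iff]
      exact (hk.image continuous_subtype_val).isClosed.preimage continuous_subtype_val
    · have hs' : s = (↑) '' ((↑) ⁻¹' s : Set U) := by
        rw [Set.image_preimage_eq_inter_range]
        ext y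
        induction y using OnePoint.rec <;> simp [hi]
      rw [hs', hpre]
      exact (hU.isOpenMap_subtype_val _ (hs.preimage OnePoint.continuous_coe)).preimage
        continuous_subtype_val
  have hsurj : Function.Surjective f := by
    intro y
    induction y using OnePoint.rec with
    | infty =>
      obtain ⟨x, hx, hxU⟩ := hne
      exact ⟨⟨x, hx⟩, f_neg _ hxU⟩
    | coe y => exact ⟨⟨y, subset_closure y.2⟩, f_pos _ y.2⟩
  let F : Quot (fun x y : closure U => (x : X) ∉ U ∧ (y : X) ∉ U) → OnePoint U :=
    Quot.lift f fun x y h => (f_neg x h.1).trans (f_neg y h.2).symm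
  have hF : Continuous F := continuous_quot_lift _ hf
  have hbij : Function.Bijective F := by
    refine ⟨?_, fun y => (hsurj y).imp' (Quot.mk _) fun _ h => h⟩
    rintro ⟨x⟩ ⟨y⟩ (h : f x = f y)
    by_cases hx : (x : X) ∈ U <;> by_cases hy : (y : X) ∈ U
    · rw [f_pos x hx, f_pos y hy, OnePoint.coe_eq_coe, Subtype.mk.injEq] at h
      exact congrArg _ (Subtype.ext h)
    · simp [f_pos x hx, f_neg y hy] at h
    · simp [f_neg x hx, f_pos y hy] at h
    · exact Quot.sound ⟨hx, hy⟩
  exact ⟨hF.homeoOfEquivCompactToT2 (f := Equiv.ofBijective F hbij)⟩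

section StarShaped

variable {E : Type*} [NormedAddCommGroup E] [NormedSpace ℝ E] {U : Set E}

theorem gauge_lt_one_iff_mem_of_smul_mem (hU : IsOpen U) (h0 : (0 : E) ∈ U)
    (hs : ∀ x ∈ closure U, ∀ s : ℝ, 0 ≤ s → s < 1 → s • x ∈ U) (x : E) :
    gauge U x < 1 ↔ x ∈ U := by
  refine ⟨fun h => ?_, gauge_lt_one_of_mem_of_isOpen hU⟩
  obtain ⟨b, hb, hb1, y, hy, rfl⟩ :=
    exists_lt_of_gauge_lt (absorbent_nhds_zero (hU.mem_nhds h0)) h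
  exact hs y (subset_closure hy) b hb.le hb1

theorem gauge_le_one_iff_mem_closure_of_smul_mem (hU : IsOpen U) (h0 : (0 : E) ∈ U)
    (hs : ∀ x ∈ closure U, ∀ s : ℝ, 0 ≤ s → s < 1 → s • x ∈ U) (x : E) :
    gauge U x ≤ 1 ↔ x ∈ closure U := by
  have hlt := gauge_lt_one_iff_mem_of_smul_mem hU h0 hs
  constructor
  · intro h
    have ht : Filter.Tendsto (fun r : ℝ => r • x) (nhdsWithin 1 (Set.Iio 1)) (nhds x) := by
      have : Continuous fun r : ℝ => r • x := by fun_prop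
      exact tendsto_nhdsWithin_of_tendsto_nhds (by simpa using this.tendsto 1)
    refine mem_closure_of_tendsto ht ?_
    filter_upwards [Ico_mem_nhdsLT (zero_lt_one' ℝ)] with r hr
    rw [← hlt, gauge_smul_of_nonneg hr.1, smul_eq_mul]
    nlinarith [hr.1, hr.2, gauge_nonneg (s := U) x]
  · intro h
    by_contra! hg
    have hpos : 0 < gauge U x := by linarith
    have := (hlt _).mpr (hs x h (gauge U x)⁻¹ (by positivity) (inv_lt_one_of_one_lt₀ hg))
    rw [gauge_smul_of_nonneg (by positivity), smul_eq_mul, inv_mul_cancel₀ hpos.ne'] at this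
    exact lt_irrefl _ this

theorem continuous_gauge_of_smul_mem (hU : IsOpen U) (h0 : (0 : E) ∈ U)
    (hs : ∀ x ∈ closure U, ∀ s : ℝ, 0 ≤ s → s < 1 → s • x ∈ U) : Continuous (gauge U) := by
  have hsc : ∀ r : ℝ, 0 < r → ∀ x : E, gauge U (r⁻¹ • x) = r⁻¹ * gauge U x := fun r hr x => by
    rw [gauge_smul_of_nonneg (by positivity), smul_eq_mul]
  rw [continuous_iff_lower_upperSemicontinuous, lowerSemicontinuous_iff_isClosed_preimage,
    upperSemicontinuous_iff_isOpen_preimage]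
  constructor
  · intro r
    rcases lt_trichotomy r 0 with hr | rfl | hr
    · convert isClosed_empty
      ext x
      simpa using hr.trans_le (gauge_nonneg x)
    · have : gauge U ⁻¹' Set.Iic 0 = ⋂ t : Set.Ioi (0 : ℝ), (fun x => t.1⁻¹ • x) ⁻¹' closure U := by
        ext x
        simp only [Set.mem_preimage, Set.mem_Iic, Set.mem_iInter, Subtype.forall, Set.mem_Ioi,
          ← gauge_le_one_iff_mem_closure_of_smul_mem hU h0 hs]
        refine ⟨fun h t ht => ?_, fun h => le_of_forall_pos_le_add fun t ht => ?_⟩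
        · rw [hsc t ht, inv_mul_le_one₀ ht]
          exact h.trans ht.le
        · have := h t ht
          rwa [hsc t ht, inv_mul_le_one₀ ht, ← zero_add t] at this
      rw [this]
      exact isClosed_iInter fun t => isClosed_closure.preimage (by fun_prop)
    · have : gauge U ⁻¹' Set.Iic r = (fun x => r⁻¹ • x) ⁻¹' closure U := by
        ext x
        rw [Set.mem_preimage, Set.mem_preimage, Set.mem_Iic,
          ← gauge_le_one_iff_mem_closure_of_smul_mem hU h0 hs, hsc r hr, inv_mul_le_one₀ hr]
      rw [this]
      exact isClosed_closure.preimage (by fun_prop)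
  · intro r
    rcases le_or_gt r 0 with hr | hr
    · convert isOpen_empty
      ext x
      simpa using hr.trans (gauge_nonneg x)
    · have : gauge U ⁻¹' Set.Iio r = (fun x => r⁻¹ • x) ⁻¹' U := by
        ext x
        rw [Set.mem_preimage, Set.mem_preimage, Set.mem_Iio,
          ← gauge_lt_one_iff_mem_of_smul_mem hU h0 hs, hsc r hr, inv_mul_lt_one₀ hr]
      rw [this]
      exact hU.preimage (by fun_prop)

/-- An open set that is strictly star-shaped about the origin is homeomorphic to the whole space. -/
theorem nonempty_homeomorph_of_smul_mem (hU : IsOpen U) (h0 : (0 : E) ∈ U)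
    (hs : ∀ x ∈ closure U, ∀ s : ℝ, 0 ≤ s → s < 1 → s • x ∈ U) : Nonempty (U ≃ₜ E) := by
  have hlt := gauge_lt_one_iff_mem_of_smul_mem hU h0 hs
  have hcont := continuous_gauge_of_smul_mem hU h0 hs
  have hpos : ∀ x : U, 0 < 1 - gauge U (x : E) := fun x => sub_pos.mpr ((hlt x).mpr x.2)
  have hpos' : ∀ y : E, 0 < 1 + gauge U y := fun y => by linarith [gauge_nonneg (s := U) y]
  have hmul : ∀ (a : ℝ) (y : E), 0 ≤ a → gauge U (a • y) = a * gauge U y := fun a y ha => by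
    rw [gauge_smul_of_nonneg ha, smul_eq_mul]
  refine ⟨{
    toFun := fun x => (1 - gauge U (x : E))⁻¹ • (x : E)
    invFun := fun y => ⟨(1 + gauge U y)⁻¹ • y, ?_⟩
    left_inv := fun x => Subtype.ext ?_
    right_inv := fun y => ?_
    continuous_toFun := ?_
    continuous_invFun := ?_ }⟩
  · rw [← hlt, hmul _ _ (inv_nonneg.mpr (hpos' y).le), inv_mul_lt_one₀ (hpos' y)]
    linarith
  · have h := hpos x
    simp only [hmul _ _ (inv_nonneg.mpr h.le), smul_smul]
    convert one_smul ℝ (x : E)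
    field_simp
    ring
  · have h := hpos' y
    simp only [hmul _ _ (inv_nonneg.mpr h.le), smul_smul]
    convert one_smul ℝ y
    field_simp
    ring
  · exact ((continuous_const.sub (hcont.comp continuous_subtype_val)).inv₀
      fun x => (hpos x).ne').smul continuous_subtype_val
  · exact (((continuous_const.add hcont).inv₀ fun y => (hpos' y).ne').smul
      continuous_id).subtype_mk _

/-- An open set that is strictly star-shaped about a point is homeomorphic to the whole space. -/
theorem nonempty_homeomorph_of_add_smul_sub_mem {c : E} (hU : IsOpen U) (hc : c ∈ U)
    (hs : ∀ x ∈ closure U, ∀ s : ℝ, 0 ≤ s → s < 1 → c + s • (x - c) ∈ U) : Nonempty (U ≃ₜ E) := by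
  let e : E ≃ₜ E := Homeomorph.addLeft c
  obtain ⟨φ⟩ := nonempty_homeomorph_of_smul_mem (U := e ⁻¹' U) (hU.preimage e.continuous)
    (by simpa [e] using hc) fun x hx s h0 h1 => by
      rw [← e.preimage_closure] at hx
      simpa [e] using hs _ hx s h0 h1
  exact ⟨(e.sets rfl).symm.trans φ⟩

/-- Collapsing the boundary of a bounded open strictly star-shaped set yields a sphere. -/
theorem nonempty_quot_closure_homeomorph_sphere [FiniteDimensional ℝ E] [Nontrivial E]
    {ι : Type*} [Fintype ι] (hι : Module.finrank ℝ E + 1 = Fintype.card ι) {c : E}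
    (hU : IsOpen U) (hb : Bornology.IsBounded U) (hc : c ∈ U)
    (hs : ∀ x ∈ closure U, ∀ s : ℝ, 0 ≤ s → s < 1 → c + s • (x - c) ∈ U) :
    Nonempty (Quot (fun x y : closure U => (x : E) ∉ U ∧ (y : E) ∉ U) ≃ₜ
      Metric.sphere (0 : EuclideanSpace ℝ ι) 1) := by
  have : ProperSpace E := FiniteDimensional.proper ℝ E
  have : NoncompactSpace E := NormedSpace.noncompactSpace ℝ E
  have hcomp : IsCompact (closure U) := hb.isCompact_closure
  have hne : (closure U \ U).Nonempty := by
    rw [Set.sdiff_nonempty]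
    intro h
    rcases isClopen_iff.mp ⟨isClosed_of_closure_subset h, hU⟩ with h' | h'
    · simp [h'] at hc
    · rw [h', closure_univ] at hcomp
      exact noncompact_univ E hcomp
  obtain ⟨e⟩ := nonempty_quot_closure_homeomorph_onePoint hU hcomp hne
  obtain ⟨φ⟩ := nonempty_homeomorph_of_add_smul_sub_mem hU hc hs
  exact ⟨(e.trans φ.onePointCongr).trans (onePointEquivSphereOfFinrankEq hι)⟩

end StarShaped

theorem continuous_maxDist {n : ℕ} (i : Fin n) (S : Finset (Fin n)) :
    Continuous fun z : Fin n → ℝ => maxDist z i S := by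
  unfold maxDist
  split_ifs with h
  · exact Continuous.finset_sup'_apply h fun j _ => by fun_prop
  · exact continuous_const

theorem continuous_nu (n : ℕ) (I : Finset (Fin n)) (i : Fin n) :
    Continuous fun z : Fin n → ℝ => nu n z I i := by
  unfold nu
  split_ifs with h
  · exact Continuous.finset_inf'_apply h fun S _ => continuous_maxDist i S
  · exact continuous_const

theorem continuous_delta (n : ℕ) : Continuous (delta n) := by
  unfold delta
  split_ifs with h
  · exact ((Continuous.finset_sup'_apply h fun j _ => continuous_apply j).sub
      (Continuous.finset_inf'_apply h fun j _ => continuous_apply j)).div_const _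
  · exact continuous_const

theorem continuous_ydot (n : ℕ) : Continuous (ydot n) := by
  refine continuous_pi fun i => ?_
  unfold ydot
  split_ifs with h
  · exact continuous_apply _
  · exact continuous_const

theorem delta_eq_of_forall_le {n : ℕ} {z : Fin n → ℝ} {i j : Fin n} (hi : ∀ k, z i ≤ z k)
    (hj : ∀ k, z k ≤ z j) : delta n z = (z j - z i) / n := by
  have h : (Finset.univ : Finset (Fin n)).Nonempty := ⟨i, mem_univ i⟩
  rw [delta, dif_pos h, le_antisymm (sup'_le h z fun k _ => hj k) (le_sup' z (mem_univ j)),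
    le_antisymm (inf'_le z (mem_univ i)) (le_inf' h z fun k _ => hi k)]

theorem nu_le_mul_nu {n : ℕ} {z w : Fin n → ℝ} {I : Finset (Fin n)} {i : Fin n} {s : ℝ}
    (h : ∀ k ∈ I, |w i - w k| ≤ s * |z i - z k|) (hs : 0 ≤ s) :
    nu n w I i ≤ s * nu n z I i := by
  unfold nu
  split_ifs with hne
  · obtain ⟨S, hS, hSe⟩ := exists_mem_eq_inf' hne (maxDist z i)
    rw [hSe]
    refine (inf'_le _ hS).trans ?_
    unfold maxDist
    split_ifs with hSn
    · refine sup'_le hSn _ fun k hk => (h k ?_).trans ?_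
      · exact mem_of_mem_erase ((mem_powersetCard.mp hS).1 hk)
      · exact mul_le_mul_of_nonneg_left (le_sup' (fun j => |z i - z j|) hk) hs
    · simp
  · simp

theorem ydot_add_smul_sub (n : ℕ) (c x : Fin (n - 1) → ℝ) (s : ℝ) (k : Fin n) :
    ydot n (c + s • (x - c)) k = s * ydot n x k + (1 - s) * ydot n c k := by
  unfold ydot
  split_ifs
  · simp only [Pi.add_apply, Pi.smul_apply, Pi.sub_apply, smul_eq_mul]
    ring
  · simp

theorem exists_ydot_bpt (n : ℕ) {I J : Finset (Fin n)} (hd : Disjoint I J)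
    (hu : I ∪ J = Finset.univ) :
    ∃ a : ℝ, (∀ i ∈ I, ydot n (bpt n I J) i = a) ∧ ∀ j ∈ J, ydot n (bpt n I J) j = a + 1 / 2 := by
  have hJI : ∀ k ∈ J, k ∉ I := fun k hk hk' => disjoint_left.mp hd hk' hk
  have hor : ∀ k, k ∈ I ∨ k ∈ J := fun k => mem_union.mp (hu ▸ mem_univ k)
  rcases Nat.eq_zero_or_pos n with rfl | hn
  · exact ⟨0, fun i => i.elim0, fun i => i.elim0⟩
  have hlast : ∀ k : Fin n, ¬ (k : ℕ) < n - 1 → k = ⟨n - 1, by omega⟩ := fun k hk =>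
    Fin.ext (by have := k.2; simp only; omega)
  have hcast : ∀ (k : Fin n) (h : (k : ℕ) < n - 1),
    Fin.castLE (Nat.sub_le n 1) ⟨k, h⟩ = k := fun k h => rfl
  by_cases hJ : (⟨n - 1, by omega⟩ : Fin n) ∈ J
  · refine ⟨-(1 / 2), fun i hi => ?_, fun j hj => ?_⟩
    · have : (i : ℕ) < n - 1 := by
        by_contra h
        exact hJI _ hJ (hlast i h ▸ hi)
      simp [ydot, bpt, hJ, this, hcast, hi]
    · unfold ydot
      split_ifs with h
      · simp [bpt, hJ, hcast, hJI j hj]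
      · norm_num
  · refine ⟨0, fun i hi => ?_, fun j hj => ?_⟩
    · unfold ydot
      split_ifs with h
      · simp [bpt, hJ, hcast, hi]
      · rfl
    · have : (j : ℕ) < n - 1 := by
        by_contra h
        exact hJ (hlast j h ▸ hj)
      simp [ydot, bpt, hJ, this, hcast, hJI j hj]

theorem abs_bpt_le (n : ℕ) (I J : Finset (Fin n)) (k : Fin (n - 1)) : |bpt n I J k| ≤ 1 / 2 := by
  unfold bpt
  split_ifs <;> norm_num [abs_le]

theorem isOpen_setAIJ (n : ℕ) (I J : Finset (Fin n)) : IsOpen (setAIJ n I J) := by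
  have hy := continuous_ydot n
  have hδ := (continuous_delta n).comp hy
  have : setAIJ n I J = (⋂ i, {y | y i ∈ Set.Ioo (-1 : ℝ) 1}) ∩ ⋂ i ∈ I, ⋂ j ∈ J,
      ({y | delta n (ydot n y) < ydot n y j - ydot n y i} ∩
        ({y | nu n (ydot n y) I i < delta n (ydot n y)} ∩
          {y | nu n (ydot n y) J j < delta n (ydot n y)})) := by
    ext y
    simp [setAIJ, IntD]
  rw [this]
  refine (isOpen_iInter_of_finite fun i => isOpen_Ioo.preimage (continuous_apply i)).inter
    (isOpen_biInter_finset fun i _ => isOpen_biInter_finset fun j _ => ?_)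
  exact (isOpen_lt hδ (((continuous_apply j).comp hy).sub ((continuous_apply i).comp hy))).inter
    ((isOpen_lt ((continuous_nu n I i).comp hy) hδ).inter
      (isOpen_lt ((continuous_nu n J j).comp hy) hδ))

theorem isBounded_setAIJ (n : ℕ) (I J : Finset (Fin n)) :
    Bornology.IsBounded (setAIJ n I J) := by
  refine (Metric.isBounded_closedBall (x := 0) (r := 1)).subset fun y hy => ?_
  rw [mem_closedBall_zero_iff, pi_norm_le_iff_of_nonneg zero_le_one]
  exact fun i => abs_le.mpr ⟨(hy.1 i).1.le, (hy.1 i).2.le⟩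

/-- The set cut out by the non-strict versions of the inequalities defining `setAIJ`. -/
def weakAIJ (n : ℕ) (I J : Finset (Fin n)) : Set (Fin (n - 1) → ℝ) :=
  {y | (∀ k, |y k| ≤ 1) ∧ ∀ i ∈ I, ∀ j ∈ J,
    delta n (ydot n y) ≤ ydot n y j - ydot n y i ∧
    nu n (ydot n y) I i ≤ delta n (ydot n y) ∧
    nu n (ydot n y) J j ≤ delta n (ydot n y)}

theorem closure_setAIJ_subset (n : ℕ) (I J : Finset (Fin n)) :
    closure (setAIJ n I J) ⊆ weakAIJ n I J := by
  have hy := continuous_ydot n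
  have hδ := (continuous_delta n).comp hy
  refine closure_minimal (fun y h => ⟨fun k => abs_le.mpr ⟨(h.1 k).1.le, (h.1 k).2.le⟩,
    fun i hi j hj => ⟨(h.2 i hi j hj).1.le, (h.2 i hi j hj).2.1.le, (h.2 i hi j hj).2.2.le⟩⟩) ?_
  have : weakAIJ n I J = (⋂ k, {y | |y k| ≤ 1}) ∩ ⋂ i ∈ I, ⋂ j ∈ J,
      ({y | delta n (ydot n y) ≤ ydot n y j - ydot n y i} ∩
        ({y | nu n (ydot n y) I i ≤ delta n (ydot n y)} ∩
          {y | nu n (ydot n y) J j ≤ delta n (ydot n y)})) := by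
    ext y
    simp [weakAIJ]
  rw [this]
  refine (isClosed_iInter fun i => isClosed_le (by fun_prop) (by fun_prop)).inter
    (isClosed_biInter fun i _ => isClosed_biInter fun j _ => ?_)
  exact (isClosed_le hδ (((continuous_apply j).comp hy).sub ((continuous_apply i).comp hy))).inter
    ((isClosed_le ((continuous_nu n I i).comp hy) hδ).inter
      (isClosed_le ((continuous_nu n J j).comp hy) hδ))

theorem zero_mem_weakAIJ (n : ℕ) (I J : Finset (Fin n)) : 0 ∈ weakAIJ n I J := by
  have h0 : ydot n 0 = 0 := by
    funext k
    simp [ydot]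
  have hδ : ∀ i : Fin n, delta n 0 = 0 := fun i => by
    simp [delta_eq_of_forall_le (z := 0) (i := i) (j := i)]
  have hν : ∀ (K : Finset (Fin n)) (i : Fin n), nu n 0 K i ≤ 0 := fun K i => by
    simpa using nu_le_mul_nu (z := 0) (w := 0) (I := K) (i := i) (s := 0) (by simp) le_rfl
  refine ⟨by simp, fun i _ j _ => ?_⟩
  simp [h0, hδ i, hν]

theorem bpt_add_smul_sub_mem_setAIJ {n : ℕ} (hn : 2 ≤ n) {I J : Finset (Fin n)}
    (hI : I.Nonempty) (hJ : J.Nonempty) (hd : Disjoint I J) (hu : I ∪ J = Finset.univ)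
    {x : Fin (n - 1) → ℝ} (hx : x ∈ weakAIJ n I J) {s : ℝ} (h0 : 0 ≤ s) (h1 : s < 1) :
    bpt n I J + s • (x - bpt n I J) ∈ setAIJ n I J := by
  obtain ⟨a, haI, haJ⟩ := exists_ydot_bpt n hd hu
  have hn' : (2 : ℝ) ≤ n := by exact_mod_cast hn
  have hor : ∀ k, k ∈ I ∨ k ∈ J := fun k => mem_union.mp (hu ▸ mem_univ k)
  set z := ydot n x with hz
  set w := ydot n (bpt n I J + s • (x - bpt n I J)) with hw
  have hwI : ∀ i ∈ I, w i = s * z i + (1 - s) * a := fun i hi => by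
    rw [hw, ydot_add_smul_sub, haI i hi]
  have hwJ : ∀ j ∈ J, w j = s * z j + (1 - s) * (a + 1 / 2) := fun j hj => by
    rw [hw, ydot_add_smul_sub, haJ j hj]
  have hδ0 : 0 ≤ delta n z := by
    have h : (Finset.univ : Finset (Fin n)).Nonempty := hI.mono (subset_univ I)
    obtain ⟨k, hk⟩ := hI
    rw [delta, dif_pos h]
    exact div_nonneg (sub_nonneg.mpr ((inf'_le z (mem_univ k)).trans (le_sup' z (mem_univ k))))
      (by positivity)
  have hIJ : ∀ i ∈ I, ∀ j ∈ J, z i ≤ z j := fun i hi j hj => by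
    linarith [(hx.2 i hi j hj).1]
  obtain ⟨p, hp, hpmin⟩ := exists_min_image I z hI
  obtain ⟨q, hq, hqmax⟩ := exists_max_image J z hJ
  have hzp : ∀ k, z p ≤ z k := fun k => (hor k).elim (hpmin k) (hIJ p hp k)
  have hzq : ∀ k, z k ≤ z q := fun k => (hor k).elim (fun hk => hIJ k hk q hq) (hqmax k)
  have hwp : ∀ k, w p ≤ w k := fun k => by
    have := mul_le_mul_of_nonneg_left (hzp k) h0
    rcases hor k with hk | hk
    · rw [hwI p hp, hwI k hk]; linarith
    · rw [hwI p hp, hwJ k hk]; linarith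
  have hwq : ∀ k, w k ≤ w q := fun k => by
    have := mul_le_mul_of_nonneg_left (hzq k) h0
    rcases hor k with hk | hk
    · rw [hwJ q hq, hwI k hk]; linarith
    · rw [hwJ q hq, hwJ k hk]; linarith
  have hδ : delta n w = s * delta n z + (1 - s) / 2 / n := by
    rw [delta_eq_of_forall_le hwp hwq, delta_eq_of_forall_le hzp hzq, hwI p hp, hwJ q hq]
    ring
  have hε : 0 < (1 - s) / 2 / n := by
    have : 0 < 1 - s := by linarith
    positivity
  have hε' : (1 - s) / 2 / n < (1 - s) / 2 := div_lt_self (by linarith) (by linarith)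
  refine ⟨fun k => ?_, fun i hi j hj => ?_⟩
  · have hb := abs_le.mp (abs_bpt_le n I J k)
    have hxk := abs_le.mp (hx.1 k)
    simp only [Pi.add_apply, Pi.smul_apply, Pi.sub_apply, smul_eq_mul]
    constructor <;> nlinarith
  · obtain ⟨h, hνI, hνJ⟩ := hx.2 i hi j hj
    have key : ∀ (K : Finset (Fin n)) (k : Fin n) (b : ℝ), k ∈ K →
        (∀ l ∈ K, w l = s * z l + b) → nu n z K k ≤ delta n z → nu n w K k < delta n w := by
      intro K k b hk hK hν
      have hle : nu n w K k ≤ s * nu n z K k := nu_le_mul_nu (fun l hl => by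
        rw [hK k hk, hK l hl, add_sub_add_right_eq_sub, ← mul_sub, abs_mul, abs_of_nonneg h0]) h0
      have := mul_le_mul_of_nonneg_left hν h0
      linarith
    refine ⟨?_, key I i _ hi hwI hνI, key J j _ hj hwJ hνJ⟩
    change delta n w < w j - w i
    have := mul_le_mul_of_nonneg_left h h0
    rw [hδ, hwI i hi, hwJ j hj]
    linarith

/-- For each `(I,J) ∈ O`, the quotient of the closure `cl(A_{I,J})` obtained by identifying
all points of `cl(A_{I,J}) \ A_{I,J}` to a single point is homeomorphic to the
`(n-1)`-sphere, i.e. the unit sphere in `ℝⁿ`. -/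
theorem stmt_7 (n : ℕ) (hn : 2 ≤ n) (I J : Finset (Fin n)) (hIJ : memO n I J) :
    Nonempty (Quot (fun x y : closure (setAIJ n I J) =>
        (x : Fin (n - 1) → ℝ) ∉ setAIJ n I J ∧ (y : Fin (n - 1) → ℝ) ∉ setAIJ n I J) ≃ₜ
      Metric.sphere (0 : EuclideanSpace ℝ (Fin n)) 1) := by
  obtain ⟨hI, hJ, hd, hu, -, -⟩ := hIJ
  have : Nonempty (Fin (n - 1)) := ⟨⟨0, by omega⟩⟩
  have hstar {x : Fin (n - 1) → ℝ} (hx : x ∈ weakAIJ n I J) {s : ℝ} (h0 : 0 ≤ s) (h1 : s < 1) :=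
    bpt_add_smul_sub_mem_setAIJ hn hI hJ hd hu hx h0 h1
  have hc : bpt n I J ∈ setAIJ n I J := by
    simpa using hstar (zero_mem_weakAIJ n I J) le_rfl zero_lt_one
  refine nonempty_quot_closure_homeomorph_sphere ?_ (isOpen_setAIJ n I J) (isBounded_setAIJ n I J)
    hc fun x hx s h0 h1 => hstar (closure_setAIJ_subset n I J hx) h0 h1
  rw [Module.finrank_fin_fun, Fintype.card_fin]
  omega
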